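/- arXiv:2010.05217 — 4 statements merged into one kernel-verified Lean document; each statement's English description precedes it below -/
import Mathlib

section
/- Suppose the matrices 𝒜, S(0), Λ(0) satisfy the identity 𝒜S(0) − S(0)𝒜* = i Λ(0) j Λ(0)*, and the matrix functions Λ(x), S(x) solve Λ′(x) = −i 𝒜 Λ(x) j H(x) and S′(x) = Λ(x) j H(x) j Λ(x)* on [0,∞) with these initial values. Then for every x ≥ 0 one has the identity 𝒜S(x) − S(x)𝒜* = i Λ(x) j Λ(x)*. -/
open Matrix

/-- Product rule for matrix products, with derivatives taken entrywise. -/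
theorem Matrix.hasDerivAt_mul_apply {l m n : Type*} [Fintype m]
    {A : ℝ → Matrix l m ℂ} {B : ℝ → Matrix m n ℂ} {A' : Matrix l m ℂ} {B' : Matrix m n ℂ} {x : ℝ}
    (hA : ∀ i k, HasDerivAt (fun t => A t i k) (A' i k) x)
    (hB : ∀ i k, HasDerivAt (fun t => B t i k) (B' i k) x) (i : l) (k : n) :
    HasDerivAt (fun t => (A t * B t) i k) ((A' * B x + A x * B') i k) x := by
  simp only [Matrix.add_apply, Matrix.mul_apply, ← Finset.sum_add_distrib]
  exact HasDerivAt.fun_sum fun p _ => (hA i p).mul (hB p k)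

/-- A matrix function whose entries have zero derivative on `[0, ∞)` is constant there. -/
theorem Matrix.eq_of_hasDerivAt_apply_zero {m n : Type*} {F : ℝ → Matrix m n ℂ}
    (hF : ∀ x : ℝ, 0 ≤ x → ∀ i k, HasDerivAt (fun t => F t i k) 0 x) {x : ℝ} (hx : 0 ≤ x) :
    F x = F 0 := by
  ext i k
  exact constant_of_has_deriv_right_zero
    (fun y hy => (hF y hy.1 i k).continuousAt.continuousWithinAt)
    (fun y hy => (hF y hy.1 i k).hasDerivWithinAt) x ⟨hx, le_rfl⟩

/-- Given GBDT data: matrices `𝒜`, `S 0`, `Λ 0` satisfying the identity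
`𝒜 S(0) − S(0) 𝒜* = i Λ(0) j Λ(0)*`, and matrix functions `Λ`, `S` solving
`Λ′(x) = −i 𝒜 Λ(x) j H(x)`, `S′(x) = Λ(x) j H(x) j Λ(x)*` on `[0,∞)`,
the identity `𝒜 S(x) − S(x) 𝒜* = i Λ(x) j Λ(x)*` holds for every `x ≥ 0`. -/
theorem gbdt_identity_propagates
    {m₁ m₂ n : ℕ} (hm₁ : 0 < m₁) (hm₂ : 0 < m₂) (hn : 0 < n)
    (j : Matrix (Fin m₁ ⊕ Fin m₂) (Fin m₁ ⊕ Fin m₂) ℂ)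
    (hj : j = Matrix.fromBlocks 1 0 0 (-1))
    (H : ℝ → Matrix (Fin m₁ ⊕ Fin m₂) (Fin m₁ ⊕ Fin m₂) ℂ)
    (hHcont : Continuous H)
    (hHsa : ∀ x : ℝ, 0 ≤ x → (H x)ᴴ = H x)
    (𝒜 : Matrix (Fin n) (Fin n) ℂ)
    (S : ℝ → Matrix (Fin n) (Fin n) ℂ)
    (Λ : ℝ → Matrix (Fin n) (Fin m₁ ⊕ Fin m₂) ℂ)
    (hS0sa : (S 0)ᴴ = S 0)
    (hid0 : 𝒜 * S 0 - S 0 * 𝒜ᴴ = Complex.I • (Λ 0 * j * (Λ 0)ᴴ))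
    (hΛ : ∀ x : ℝ, 0 ≤ x → ∀ i k, HasDerivAt (fun t => Λ t i k)
      (((-Complex.I) • (𝒜 * Λ x * j * H x)) i k) x)
    (hS : ∀ x : ℝ, 0 ≤ x → ∀ i k, HasDerivAt (fun t => S t i k)
      ((Λ x * j * H x * j * (Λ x)ᴴ) i k) x) :
    ∀ x : ℝ, 0 ≤ x → 𝒜 * S x - S x * 𝒜ᴴ = Complex.I • (Λ x * j * (Λ x)ᴴ) := by
  have hjsa : jᴴ = j := by
    rw [hj, Matrix.fromBlocks_conjTranspose]
    simp
  intro x hx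
  have hconst := Matrix.eq_of_hasDerivAt_apply_zero
    (F := fun t => 𝒜 * S t - S t * 𝒜ᴴ - Complex.I • (Λ t * j * (Λ t)ᴴ)) ?_ hx
  · simpa only [hid0, sub_self, sub_eq_zero] using hconst
  intro y hy i k
  have hconstDeriv : ∀ {p q : Type} (M : Matrix p q ℂ) (a : p) (b : q),
      HasDerivAt (fun _ : ℝ => M a b) ((0 : Matrix p q ℂ) a b) y :=
    fun M a b => hasDerivAt_const y (M a b)
  have hΛstar : ∀ a b, HasDerivAt (fun t => (Λ t)ᴴ a b)
      (((-Complex.I) • (𝒜 * Λ y * j * H y))ᴴ a b) y :=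
    fun a b => (hΛ y hy b a).star
  have hAS := Matrix.hasDerivAt_mul_apply (hconstDeriv 𝒜) (hS y hy) i k
  have hSA := Matrix.hasDerivAt_mul_apply (hS y hy) (hconstDeriv 𝒜ᴴ) i k
  have hΛjΛ := Matrix.hasDerivAt_mul_apply
    (Matrix.hasDerivAt_mul_apply (hΛ y hy) (hconstDeriv j)) hΛstar i k
  refine ((hAS.sub hSA).sub (hΛjΛ.const_mul Complex.I)).congr_deriv ?_
  rw [← smul_eq_mul Complex.I, ← Matrix.smul_apply, ← Matrix.sub_apply, ← Matrix.sub_apply]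
  refine congrFun (congrFun (?_ : _ = (0 : Matrix (Fin n) (Fin n) ℂ)) i) k
  simp only [neg_smul, Matrix.conjTranspose_neg, Matrix.conjTranspose_smul,
    Matrix.conjTranspose_mul, hjsa, hHsa y hy, Matrix.zero_mul, Matrix.mul_zero, zero_add, add_zero,
    Matrix.neg_mul, Matrix.smul_mul, Matrix.mul_smul, smul_add, smul_neg, smul_smul,
    Complex.star_def, Complex.conj_I, neg_neg, Complex.I_mul_I, one_smul, Matrix.mul_assoc]
  abel
end

section
/- Assume the GBDT data, assume S(x) is invertible for every x ≥ 0, and let λ ∈ ℂ be such that 𝒜 − λI_n is invertible. Then the transfer matrix function w_𝒜(x,λ) = I_m − i j Λ(x)* S(x)^{−1} (𝒜 − λI_n)^{−1} Λ(x) satisfies the differential equation ∂ₓ w_𝒜(x,λ) = (iλ j H(x) − q̃₀(x)) w_𝒜(x,λ) − iλ w_𝒜(x,λ) j H(x) for all x ≥ 0, where q̃₀(x) = j Λ(x)* S(x)^{−1} Λ(x) j H(x) − j H(x) j Λ(x)* S(x)^{−1} Λ(x). -/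
open Matrix

section EntrywiseDerivative

variable {l m n : Type*}

/-- Entrywise differentiability of a matrix function of a real variable. -/
def HasEntrywiseDerivAt (M : ℝ → Matrix m n ℂ) (M' : Matrix m n ℂ) (x : ℝ) : Prop :=
  ∀ i k, HasDerivAt (fun t => M t i k) (M' i k) x

namespace HasEntrywiseDerivAt

variable {x : ℝ}

theorem const (M : Matrix m n ℂ) (x : ℝ) : HasEntrywiseDerivAt (fun _ => M) 0 x :=
  fun i k => hasDerivAt_const x (M i k)

theorem sub {M N : ℝ → Matrix m n ℂ} {M' N' : Matrix m n ℂ}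
    (hM : HasEntrywiseDerivAt M M' x) (hN : HasEntrywiseDerivAt N N' x) :
    HasEntrywiseDerivAt (fun t => M t - N t) (M' - N') x :=
  fun i k => (hM i k).sub (hN i k)

theorem const_smul {M : ℝ → Matrix m n ℂ} {M' : Matrix m n ℂ} (c : ℂ)
    (hM : HasEntrywiseDerivAt M M' x) :
    HasEntrywiseDerivAt (fun t => c • M t) (c • M') x :=
  fun i k => (hM i k).const_mul c

theorem conjTranspose {M : ℝ → Matrix m n ℂ} {M' : Matrix m n ℂ}
    (hM : HasEntrywiseDerivAt M M' x) :
    HasEntrywiseDerivAt (fun t => (M t)ᴴ) M'ᴴ x :=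
  fun i k => (hM k i).star

theorem mul [Fintype m] {M : ℝ → Matrix l m ℂ} {N : ℝ → Matrix m n ℂ}
    {M' : Matrix l m ℂ} {N' : Matrix m n ℂ}
    (hM : HasEntrywiseDerivAt M M' x) (hN : HasEntrywiseDerivAt N N' x) :
    HasEntrywiseDerivAt (fun t => M t * N t) (M' * N x + M x * N') x := by
  intro i k
  simp only [Matrix.mul_apply, Matrix.add_apply, ← Finset.sum_add_distrib]
  exact HasDerivAt.fun_sum fun p _ => (hM i p).mul (hN p k)

theorem const_mul [Fintype m] (C : Matrix l m ℂ) {M : ℝ → Matrix m n ℂ} {M' : Matrix m n ℂ}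
    (hM : HasEntrywiseDerivAt M M' x) :
    HasEntrywiseDerivAt (fun t => C * M t) (C * M') x := by
  simpa using (const C x).mul hM

theorem mul_const [Fintype m] {M : ℝ → Matrix l m ℂ} {M' : Matrix l m ℂ} (C : Matrix m n ℂ)
    (hM : HasEntrywiseDerivAt M M' x) :
    HasEntrywiseDerivAt (fun t => M t * C) (M' * C) x := by
  simpa using hM.mul (const C x)

open scoped Matrix.Norms.Operator in
theorem inv [Fintype n] [DecidableEq n] {M : ℝ → Matrix n n ℂ} {M' : Matrix n n ℂ}
    (hM : HasEntrywiseDerivAt M M' x) (hu : IsUnit (M x)) :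
    HasEntrywiseDerivAt (fun t => (M t)⁻¹) (-((M x)⁻¹ * M' * (M x)⁻¹)) x := by
  have hD : HasDerivAt M M' x := hasDerivAt_pi.2 fun i => hasDerivAt_pi.2 fun k => hM i k
  obtain ⟨u, hu⟩ := hu
  have hF := hasFDerivAt_ringInverse (𝕜 := ℝ) u
  rw [hu] at hF
  have hI := hF.comp_hasDerivAt x hD
  intro i k
  have := hasDerivAt_pi.1 (hasDerivAt_pi.1 hI i) k
  have hinv : (M x)⁻¹ = ↑u⁻¹ := by
    rw [Matrix.nonsing_inv_eq_ringInverse, ← hu, Ring.inverse_unit]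
  rw [hinv]
  simp only [Matrix.nonsing_inv_eq_ringInverse]
  exact this

/-- A matrix function with vanishing entrywise derivative on `[0, ∞)` is constant there. -/
theorem eq_zero_value {M : ℝ → Matrix m n ℂ}
    (hM : ∀ t, 0 ≤ t → HasEntrywiseDerivAt M 0 t) (hx : 0 ≤ x) : M x = M 0 := by
  ext i k
  exact constant_of_has_deriv_right_zero (f := fun t => M t i k)
    (fun t ht => (hM t ht.1 i k).continuousAt.continuousWithinAt)
    (fun t ht => (hM t ht.1 i k).hasDerivWithinAt) x ⟨hx, le_rfl⟩

end HasEntrywiseDerivAt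

end EntrywiseDerivative

section GBDT

variable {m n : Type*} [Fintype m] [Fintype n] {j : Matrix m m ℂ} {H : ℝ → Matrix m m ℂ}
  {𝒜 : Matrix n n ℂ} {S : ℝ → Matrix n n ℂ} {Λ : ℝ → Matrix n m ℂ}

/-- The GBDT identity `𝒜 S − S 𝒜* = i Λ j Λ*` propagates from `0` to all `x ≥ 0`. -/
theorem gbdt_identity (hjsa : jᴴ = j) (hH : ∀ x, 0 ≤ x → (H x)ᴴ = H x)
    (hid0 : 𝒜 * S 0 - S 0 * 𝒜ᴴ = Complex.I • (Λ 0 * j * (Λ 0)ᴴ))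
    (hΛ : ∀ x, 0 ≤ x → HasEntrywiseDerivAt Λ ((-Complex.I) • (𝒜 * Λ x * j * H x)) x)
    (hS : ∀ x, 0 ≤ x → HasEntrywiseDerivAt S (Λ x * j * H x * j * (Λ x)ᴴ) x)
    {x : ℝ} (hx : 0 ≤ x) :
    𝒜 * S x - S x * 𝒜ᴴ = Complex.I • (Λ x * j * (Λ x)ᴴ) := by
  rw [← sub_eq_zero] at hid0 ⊢
  rw [← hid0]
  refine HasEntrywiseDerivAt.eq_zero_value
    (M := fun t => 𝒜 * S t - S t * 𝒜ᴴ - Complex.I • (Λ t * j * (Λ t)ᴴ)) (fun t ht => ?_) hx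
  convert (((hS t ht).const_mul 𝒜).sub ((hS t ht).mul_const 𝒜ᴴ)).sub
    ((((hΛ t ht).mul_const j).mul (hΛ t ht).conjTranspose).const_smul Complex.I) using 1
  simp only [conjTranspose_smul, conjTranspose_mul, hjsa, hH t ht, Matrix.smul_mul,
    Matrix.mul_smul, smul_add, smul_smul, star_neg, Complex.star_def, Complex.conj_I,
    Matrix.mul_assoc]
  simp
  abel

/-- The algebraic identity behind the transfer matrix equation: `A`, `B`, `X`, `R`, `L` stand for
`𝒜`, `𝒜*`, `S⁻¹`, `(𝒜 − λ)⁻¹`, `Λ`, and `K` for `Λ*`. -/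
theorem gbdt_transfer_algebra [DecidableEq m] [DecidableEq n] {A B X R : Matrix n n ℂ}
    {L : Matrix n m ℂ} {K : Matrix m n ℂ} {J G : Matrix m m ℂ} {lam : ℂ}
    (hB : B * X = X * A - Complex.I • (X * L * J * K * X))
    (hAR : A * R = 1 + lam • R) (hRA : R * A = 1 + lam • R) :
    -(Complex.I • (J * (Complex.I • (G * J * K * B)) * X * R * L
        + J * K * -(X * (L * J * G * J * K) * X) * R * L
        + J * K * X * R * ((-Complex.I) • (A * L * J * G))))
      = ((Complex.I * lam) • (J * G) - (J * K * X * L * J * G - J * G * J * K * X * L))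
          * (1 - Complex.I • (J * K * X * R * L))
        - (Complex.I * lam) • ((1 - Complex.I • (J * K * X * R * L)) * (J * G)) := by
  have h₁ : G * J * K * B * X * R * L = G * J * K * X * L + lam • (G * J * K * X * R * L)
      - Complex.I • (G * J * K * X * L * J * K * X * R * L) := by
    have := congrArg (fun Z => G * J * K * Z * R * L) hB
    have h' := congrArg (fun Z => G * J * K * X * Z * L) hAR
    simp only [Matrix.mul_sub, Matrix.sub_mul, Matrix.mul_add, Matrix.add_mul, Matrix.mul_smul,
      Matrix.smul_mul, Matrix.mul_assoc, Matrix.mul_one] at this h' ⊢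
    rw [this, h']
  have h₂ : K * X * R * A * L * J * G = K * X * L * J * G + lam • (K * X * R * L * J * G) := by
    have h' := congrArg (fun Z => K * X * Z * L * J * G) hRA
    simpa only [Matrix.mul_add, Matrix.add_mul, Matrix.mul_smul,
      Matrix.smul_mul, Matrix.mul_assoc, Matrix.mul_one, Matrix.one_mul] using h'
  simp only [Matrix.mul_assoc] at h₁ h₂
  simp only [Matrix.mul_sub, Matrix.sub_mul, Matrix.mul_add, Matrix.mul_smul,
    Matrix.smul_mul, Matrix.mul_assoc, Matrix.mul_one, Matrix.one_mul, Matrix.mul_neg,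
    Matrix.neg_mul, h₁, h₂]
  have hI : Complex.I * Complex.I = -1 := Complex.I_mul_I
  match_scalars <;> grind

end GBDT

/-- Under the GBDT data with `S(x)` invertible for all `x ≥ 0`, and `λ` such that
`𝒜 − λ Iₙ` is invertible, the transfer matrix function
`w_𝒜(x,λ) = I_m − i j Λ(x)* S(x)⁻¹ (𝒜 − λIₙ)⁻¹ Λ(x)` satisfies
`∂ₓ w_𝒜(x,λ) = (iλ j H(x) − q̃₀(x)) w_𝒜(x,λ) − iλ w_𝒜(x,λ) j H(x)` for all `x ≥ 0`, where
`q̃₀(x) = j Λ(x)* S(x)⁻¹ Λ(x) j H(x) − j H(x) j Λ(x)* S(x)⁻¹ Λ(x)`. -/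
theorem gbdt_transfer_matrix_ode
    {m₁ m₂ n : ℕ} (hm₁ : 0 < m₁) (hm₂ : 0 < m₂) (hn : 0 < n)
    (j : Matrix (Fin m₁ ⊕ Fin m₂) (Fin m₁ ⊕ Fin m₂) ℂ)
    (hj : j = Matrix.fromBlocks 1 0 0 (-1))
    (H : ℝ → Matrix (Fin m₁ ⊕ Fin m₂) (Fin m₁ ⊕ Fin m₂) ℂ)
    (hHcont : Continuous H)
    (hHsa : ∀ x : ℝ, 0 ≤ x → (H x)ᴴ = H x)
    (𝒜 : Matrix (Fin n) (Fin n) ℂ)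
    (S : ℝ → Matrix (Fin n) (Fin n) ℂ)
    (Λ : ℝ → Matrix (Fin n) (Fin m₁ ⊕ Fin m₂) ℂ)
    (hS0sa : (S 0)ᴴ = S 0)
    (hid0 : 𝒜 * S 0 - S 0 * 𝒜ᴴ = Complex.I • (Λ 0 * j * (Λ 0)ᴴ))
    (hΛ : ∀ x : ℝ, 0 ≤ x → ∀ i k, HasDerivAt (fun t => Λ t i k)
      (((-Complex.I) • (𝒜 * Λ x * j * H x)) i k) x)
    (hS : ∀ x : ℝ, 0 ≤ x → ∀ i k, HasDerivAt (fun t => S t i k)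
      ((Λ x * j * H x * j * (Λ x)ᴴ) i k) x)
    (hSinv : ∀ x : ℝ, 0 ≤ x → IsUnit (S x))
    (lam : ℂ) (hlam : IsUnit (𝒜 - lam • 1))
    (w : ℝ → Matrix (Fin m₁ ⊕ Fin m₂) (Fin m₁ ⊕ Fin m₂) ℂ)
    (hw : ∀ x : ℝ, w x =
      1 - Complex.I • (j * (Λ x)ᴴ * (S x)⁻¹ * (𝒜 - lam • 1)⁻¹ * Λ x))
    (q₀ : ℝ → Matrix (Fin m₁ ⊕ Fin m₂) (Fin m₁ ⊕ Fin m₂) ℂ)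
    (hq₀ : ∀ x : ℝ, q₀ x =
      j * (Λ x)ᴴ * (S x)⁻¹ * Λ x * j * H x - j * H x * j * (Λ x)ᴴ * (S x)⁻¹ * Λ x) :
    ∀ x : ℝ, 0 ≤ x → ∀ i k, HasDerivAt (fun t => w t i k)
      ((((Complex.I * lam) • (j * H x) - q₀ x) * w x
        - (Complex.I * lam) • (w x * (j * H x))) i k) x := by
  have hjsa : jᴴ = j := by
    rw [hj, fromBlocks_conjTranspose]
    simp
  intro x hx
  have hid := gbdt_identity hjsa hHsa hid0 hΛ hS hx
  have hdet := (Matrix.isUnit_iff_isUnit_det _).1 (hSinv x hx)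
  have hdetR := (Matrix.isUnit_iff_isUnit_det _).1 hlam
  have hB : 𝒜ᴴ * (S x)⁻¹ = (S x)⁻¹ * 𝒜
      - Complex.I • ((S x)⁻¹ * Λ x * j * (Λ x)ᴴ * (S x)⁻¹) := by
    have h := congrArg (fun Z => (S x)⁻¹ * Z * (S x)⁻¹) hid
    simp only [Matrix.mul_sub, Matrix.sub_mul, Matrix.mul_smul, Matrix.smul_mul] at h
    rw [← Matrix.mul_assoc, Matrix.mul_nonsing_inv_cancel_right _ _ hdet,
      Matrix.nonsing_inv_mul_cancel_left _ _ hdet] at h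
    simp only [Matrix.mul_assoc] at h ⊢
    rw [← h, sub_sub_cancel]
  have hAR : 𝒜 * (𝒜 - lam • 1)⁻¹ = 1 + lam • (𝒜 - lam • 1)⁻¹ := by
    have h := Matrix.mul_nonsing_inv _ hdetR
    rwa [Matrix.sub_mul, Matrix.smul_mul, Matrix.one_mul, sub_eq_iff_eq_add] at h
  have hRA : (𝒜 - lam • 1)⁻¹ * 𝒜 = 1 + lam • (𝒜 - lam • 1)⁻¹ := by
    have h := Matrix.nonsing_inv_mul _ hdetR
    rwa [Matrix.mul_sub, Matrix.mul_smul, Matrix.mul_one, sub_eq_iff_eq_add] at h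
  have hΛx : HasEntrywiseDerivAt Λ _ x := hΛ x hx
  have hSx : HasEntrywiseDerivAt S _ x := hS x hx
  have hΛs : HasEntrywiseDerivAt (fun t => (Λ t)ᴴ)
      (Complex.I • (H x * j * (Λ x)ᴴ * 𝒜ᴴ)) x := by
    convert hΛx.conjTranspose using 1
    simp [conjTranspose_mul, hjsa, hHsa x hx, Matrix.mul_assoc]
  change HasEntrywiseDerivAt w _ x
  rw [funext hw, hq₀ x]
  have key := (HasEntrywiseDerivAt.const 1 x).sub ((((((hΛs.const_mul j).mul
    (hSx.inv (hSinv x hx))).mul_const (𝒜 - lam • 1)⁻¹).mul hΛx)).const_smul Complex.I)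
  convert key using 1
  rw [zero_sub, Matrix.add_mul, Matrix.add_mul]
  exact (gbdt_transfer_algebra hB hAR hRA).symm
end

section
/- Assume the GBDT data, assume S(x) is invertible for every x ≥ 0, and assume 𝒜 is invertible. Define H̃(x) = w_𝒜(x,0)* H(x) w_𝒜(x,0) and, for λ ∈ ℂ with 𝒜 − λI_n invertible, define v(x,λ) = w_𝒜(x,0)^{−1} w_𝒜(x,λ). Then: (i) H̃(x)* = H̃(x) for all x ≥ 0, and if in addition H(x) ≥ 0 (positive semidefinite) for all x then H̃(x) ≥ 0 for all x; (ii) v satisfies the Darboux-matrix equation ∂ₓ v(x,λ) = iλ j H̃(x) v(x,λ) − iλ v(x,λ) j H(x); (iii) v admits the representation v(x,λ) = I_m − iλ j Λ(x)* (𝒜*)^{−1} S(x)^{−1} (𝒜 − λI_n)^{−1} Λ(x). -/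
open Matrix
open scoped ComplexOrder

section EntrywiseCalculus

variable {l m n : Type*} {x : ℝ}

/-- Entrywise product rule for matrix-valued functions. -/
theorem hasDerivAt_matrix_mul_apply [Fintype m] {M : ℝ → Matrix l m ℂ} {N : ℝ → Matrix m n ℂ}
    {M' : Matrix l m ℂ} {N' : Matrix m n ℂ}
    (hM : ∀ i k, HasDerivAt (fun t => M t i k) (M' i k) x)
    (hN : ∀ i k, HasDerivAt (fun t => N t i k) (N' i k) x) (i : l) (k : n) :
    HasDerivAt (fun t => (M t * N t) i k) ((M' * N x + M x * N') i k) x := by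
  simp only [Matrix.mul_apply, Matrix.add_apply, ← Finset.sum_add_distrib]
  exact HasDerivAt.fun_sum fun a _ => (hM i a).mul (hN a k)

theorem hasDerivAt_matrix_const_mul_apply [Fintype m] (C : Matrix l m ℂ) {N : ℝ → Matrix m n ℂ}
    {N' : Matrix m n ℂ} (hN : ∀ i k, HasDerivAt (fun t => N t i k) (N' i k) x) (i : l) (k : n) :
    HasDerivAt (fun t => (C * N t) i k) ((C * N') i k) x := by
  simpa using hasDerivAt_matrix_mul_apply (M := fun _ => C) (M' := 0)
    (fun i k => hasDerivAt_const x (C i k)) hN i k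

theorem hasDerivAt_matrix_mul_const_apply [Fintype m] {M : ℝ → Matrix l m ℂ} {M' : Matrix l m ℂ}
    (hM : ∀ i k, HasDerivAt (fun t => M t i k) (M' i k) x) (C : Matrix m n ℂ) (i : l) (k : n) :
    HasDerivAt (fun t => (M t * C) i k) ((M' * C) i k) x := by
  simpa using hasDerivAt_matrix_mul_apply (N := fun _ => C) (N' := 0) hM
    (fun i k => hasDerivAt_const x (C i k)) i k

theorem hasDerivAt_matrix_conjTranspose_apply {M : ℝ → Matrix l m ℂ} {M' : Matrix l m ℂ}
    (hM : ∀ i k, HasDerivAt (fun t => M t i k) (M' i k) x) (i : m) (k : l) :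
    HasDerivAt (fun t => (M t)ᴴ i k) (M'ᴴ i k) x :=
  (hM k i).star

/-- A matrix-valued function with vanishing derivative on `[0, ∞)` is constant there. -/
theorem matrix_eq_of_hasDerivAt_zero {M : ℝ → Matrix m n ℂ}
    (hM : ∀ x, 0 ≤ x → ∀ i k, HasDerivAt (fun t => M t i k) 0 x) (hx : 0 ≤ x) : M x = M 0 := by
  ext i k
  exact constant_of_has_deriv_right_zero (f := fun t => M t i k) (b := x)
    (fun t ht => (hM t ht.1 i k).continuousAt.continuousWithinAt)
    (fun t ht => (hM t ht.1 i k).hasDerivWithinAt) x ⟨hx, le_rfl⟩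

attribute [local instance] Matrix.linftyOpNormedRing Matrix.linftyOpNormedAlgebra

theorem hasDerivAt_matrix_inv_apply [Fintype n] [DecidableEq n] {M : ℝ → Matrix n n ℂ}
    {M' : Matrix n n ℂ} (hM : ∀ i k, HasDerivAt (fun t => M t i k) (M' i k) x)
    (hu : IsUnit (M x)) (i k : n) :
    HasDerivAt (fun t => (M t)⁻¹ i k) ((-((M x)⁻¹ * M' * (M x)⁻¹)) i k) x := by
  have h : HasDerivAt M M' x := hasDerivAt_pi.2 fun i => hasDerivAt_pi.2 fun k => hM i k
  obtain ⟨u, hu⟩ := hu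
  have hinv := hasFDerivAt_ringInverse (𝕜 := ℝ) u
  rw [hu] at hinv
  have hentry := hasDerivAt_pi.1 (hasDerivAt_pi.1 (hinv.comp_hasDerivAt x h) i) k
  have hfun : (fun t => (M t)⁻¹ i k) = fun t => (Ring.inverse ∘ M) t i k := by
    funext t
    rw [Matrix.nonsing_inv_eq_ringInverse]
    rfl
  rw [hfun]
  refine hentry.congr_deriv ?_
  rw [← hu, ← Matrix.coe_units_inv]
  rfl

end EntrywiseCalculus

section TransferMatrix

variable {m n : Type*} [Fintype m] [DecidableEq m] [Fintype n] [DecidableEq n]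

/-- The operator identity `A S - S A* = i Λ j Λ*`, in terms of the inverse of `S`. -/
theorem inv_mul_sub_mul_inv_of_identity {A B S G : Matrix n n ℂ} (hS : IsUnit S)
    (h : A * S - S * B = Complex.I • G) :
    S⁻¹ * A - B * S⁻¹ = Complex.I • (S⁻¹ * G * S⁻¹) := by
  have hdet := (Matrix.isUnit_iff_isUnit_det S).1 hS
  rw [← Matrix.smul_mul, ← Matrix.mul_smul, ← h, mul_sub, sub_mul, ← mul_assoc, ← mul_assoc,
    Matrix.mul_nonsing_inv_cancel_right _ _ hdet, Matrix.nonsing_inv_mul _ hdet, one_mul]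

theorem transferMatrix_mul {j : Matrix m m ℂ} {L : Matrix n m ℂ} {A T P C : Matrix n n ℂ} {ζ : ℂ}
    (hT : T * A - Aᴴ * T = Complex.I • (T * (L * j * Lᴴ) * T))
    (hP : (A - ζ • 1) * P = 1) (hC : C * Aᴴ = 1) :
    (1 + Complex.I • (j * Lᴴ * C * T * L)) * (1 - Complex.I • (j * Lᴴ * T * P * L)) =
      1 - (Complex.I * ζ) • (j * Lᴴ * C * T * P * L) := by
  have hAP : A * P = 1 + ζ • P := by
    rw [sub_mul, Matrix.smul_mul, one_mul, sub_eq_iff_eq_add] at hP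
    exact hP
  have key : C * T - T * P - Complex.I • (C * T * (L * j * Lᴴ) * T * P) = -(ζ • (C * T * P)) := by
    have hCTP : C * (T * A - Aᴴ * T) * P = C * T + ζ • (C * T * P) - T * P := by
      rw [mul_sub, sub_mul, ← mul_assoc, ← mul_assoc, hC, one_mul, mul_assoc (C * T), hAP,
        mul_add, mul_one, Matrix.mul_smul]
    have hG : Complex.I • (C * T * (L * j * Lᴴ) * T * P) = C * (T * A - Aᴴ * T) * P := by
      rw [hT]
      simp only [Matrix.mul_smul, Matrix.smul_mul, Matrix.mul_assoc]
    rw [hG, hCTP]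
    abel
  have key' := congrArg (fun X => Complex.I • (j * Lᴴ * X * L)) key
  simp only [Matrix.mul_sub, Matrix.sub_mul, Matrix.mul_smul, Matrix.smul_mul, Matrix.mul_neg,
    Matrix.neg_mul, smul_sub, smul_smul, smul_neg, Matrix.mul_assoc] at key'
  simp only [Matrix.add_mul, Matrix.mul_sub, Matrix.mul_one, Matrix.one_mul, Matrix.mul_smul,
    Matrix.smul_mul, Matrix.mul_assoc]
  linear_combination (norm := module) key'

theorem transferMatrix_deriv_identity {j H : Matrix m m ℂ} {L : Matrix n m ℂ}
    {A T P : Matrix n n ℂ} {ζ : ℂ}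
    (hj : jᴴ = j) (hH : Hᴴ = H)
    (hT : T * A - Aᴴ * T = Complex.I • (T * (L * j * Lᴴ) * T))
    (hAP : A * P = 1 + ζ • P) (hPA : P * A = 1 + ζ • P) :
    -(Complex.I • (((j * (-Complex.I • (A * L * j * H))ᴴ * T
        + j * Lᴴ * (-(T * (L * j * H * j * Lᴴ) * T))) * P) * L
        + j * Lᴴ * T * P * (-Complex.I • (A * L * j * H)))) =
      (Complex.I * ζ) • (j * H * (1 - Complex.I • (j * Lᴴ * T * P * L))
        - (1 - Complex.I • (j * Lᴴ * T * P * L)) * j * H)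
      + (j * H * j * Lᴴ * T * L - j * Lᴴ * T * L * j * H)
        * (1 - Complex.I • (j * Lᴴ * T * P * L)) := by
  have hT' : Aᴴ * T = T * A - Complex.I • (T * (L * j * Lᴴ) * T) := by
    rw [← hT]; abel
  have hadj : (-Complex.I • (A * L * j * H))ᴴ = Complex.I • (H * j * Lᴴ * Aᴴ) := by
    simp [Matrix.conjTranspose_mul, hj, hH, Matrix.mul_assoc]
  have e1 : j * (-Complex.I • (A * L * j * H))ᴴ * T * P * L =
      Complex.I • (j * H * j * Lᴴ * T * L) + (Complex.I * ζ) • (j * H * j * Lᴴ * T * P * L)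
        + j * H * j * Lᴴ * T * L * j * Lᴴ * T * P * L := by
    have : j * (-Complex.I • (A * L * j * H))ᴴ * T * P * L =
        Complex.I • (j * H * j * Lᴴ * ((Aᴴ * T) * P) * L) := by
      rw [hadj]; simp only [Matrix.mul_smul, Matrix.smul_mul, Matrix.mul_assoc]
    rw [this, hT', sub_mul, mul_assoc T A P, hAP]
    simp only [Matrix.mul_add, Matrix.add_mul, Matrix.mul_sub, Matrix.sub_mul, Matrix.mul_one,
      Matrix.mul_smul, Matrix.smul_mul, smul_add, smul_sub, smul_smul, Complex.I_mul_I,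
      Matrix.mul_assoc]
    module
  have e2 : j * Lᴴ * T * P * (-Complex.I • (A * L * j * H)) =
      -Complex.I • (j * Lᴴ * T * L * j * H) - (Complex.I * ζ) • (j * Lᴴ * T * P * L * j * H) := by
    have : j * Lᴴ * T * P * (-Complex.I • (A * L * j * H)) =
        -Complex.I • (j * Lᴴ * T * (P * A) * L * j * H) := by
      simp only [Matrix.mul_smul, Matrix.mul_assoc]
    rw [this, hPA]
    simp only [Matrix.mul_add, Matrix.add_mul, Matrix.mul_one, Matrix.mul_smul, Matrix.smul_mul]
    module
  rw [Matrix.add_mul, Matrix.add_mul, e1, e2]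
  simp only [Matrix.mul_sub, Matrix.sub_mul, Matrix.mul_one, Matrix.one_mul, Matrix.mul_neg,
    Matrix.neg_mul, Matrix.mul_smul, Matrix.smul_mul, smul_sub, smul_add, smul_neg, smul_smul,
    Matrix.mul_assoc]
  match_scalars <;> ring_nf <;> simp [Complex.I_sq]

end TransferMatrix

/-- Under the GBDT data, with `S(x)` invertible for all `x ≥ 0` and `𝒜` invertible,
set `H̃(x) = w_𝒜(x,0)* H(x) w_𝒜(x,0)` and `v(x,λ) = w_𝒜(x,0)⁻¹ w_𝒜(x,λ)` (for `𝒜 − λIₙ`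
invertible). Then (i) `H̃(x)` is Hermitian, and positive semidefinite whenever all `H(x)` are;
(ii) `∂ₓ v(x,λ) = iλ j H̃(x) v(x,λ) − iλ v(x,λ) j H(x)`;
(iii) `v(x,λ) = I_m − iλ j Λ(x)* (𝒜*)⁻¹ S(x)⁻¹ (𝒜 − λIₙ)⁻¹ Λ(x)`. -/
theorem gbdt_darboux_matrix
    {m₁ m₂ n : ℕ} (hm₁ : 0 < m₁) (hm₂ : 0 < m₂) (hn : 0 < n)
    (j : Matrix (Fin m₁ ⊕ Fin m₂) (Fin m₁ ⊕ Fin m₂) ℂ)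
    (hj : j = Matrix.fromBlocks 1 0 0 (-1))
    (H : ℝ → Matrix (Fin m₁ ⊕ Fin m₂) (Fin m₁ ⊕ Fin m₂) ℂ)
    (hHcont : Continuous H)
    (hHsa : ∀ x : ℝ, 0 ≤ x → (H x)ᴴ = H x)
    (𝒜 : Matrix (Fin n) (Fin n) ℂ)
    (S : ℝ → Matrix (Fin n) (Fin n) ℂ)
    (Λ : ℝ → Matrix (Fin n) (Fin m₁ ⊕ Fin m₂) ℂ)
    (hS0sa : (S 0)ᴴ = S 0)
    (hid0 : 𝒜 * S 0 - S 0 * 𝒜ᴴ = Complex.I • (Λ 0 * j * (Λ 0)ᴴ))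
    (hΛ : ∀ x : ℝ, 0 ≤ x → ∀ i k, HasDerivAt (fun t => Λ t i k)
      (((-Complex.I) • (𝒜 * Λ x * j * H x)) i k) x)
    (hS : ∀ x : ℝ, 0 ≤ x → ∀ i k, HasDerivAt (fun t => S t i k)
      ((Λ x * j * H x * j * (Λ x)ᴴ) i k) x)
    (hSinv : ∀ x : ℝ, 0 ≤ x → IsUnit (S x))
    (h𝒜 : IsUnit 𝒜)
    (w𝒜 : ℝ → ℂ → Matrix (Fin m₁ ⊕ Fin m₂) (Fin m₁ ⊕ Fin m₂) ℂ)
    (hw𝒜 : ∀ (x : ℝ) (ζ : ℂ), w𝒜 x ζ =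
      1 - Complex.I • (j * (Λ x)ᴴ * (S x)⁻¹ * (𝒜 - ζ • 1)⁻¹ * Λ x))
    (Htil : ℝ → Matrix (Fin m₁ ⊕ Fin m₂) (Fin m₁ ⊕ Fin m₂) ℂ)
    (hHtil : ∀ x : ℝ, Htil x = (w𝒜 x 0)ᴴ * H x * w𝒜 x 0)
    (lam : ℂ) (hlam : IsUnit (𝒜 - lam • 1))
    (v : ℝ → Matrix (Fin m₁ ⊕ Fin m₂) (Fin m₁ ⊕ Fin m₂) ℂ)
    (hv : ∀ x : ℝ, v x = (w𝒜 x 0)⁻¹ * w𝒜 x lam) :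
    (∀ x : ℝ, 0 ≤ x → (Htil x)ᴴ = Htil x) ∧
    ((∀ x : ℝ, 0 ≤ x → (H x).PosSemidef) → ∀ x : ℝ, 0 ≤ x → (Htil x).PosSemidef) ∧
    (∀ x : ℝ, 0 ≤ x → ∀ i k, HasDerivAt (fun t => v t i k)
      (((Complex.I * lam) • (j * Htil x * v x)
        - (Complex.I * lam) • (v x * j * H x)) i k) x) ∧
    (∀ x : ℝ, 0 ≤ x → v x =
      1 - (Complex.I * lam) • (j * (Λ x)ᴴ * (𝒜ᴴ)⁻¹ * (S x)⁻¹ * (𝒜 - lam • 1)⁻¹ * Λ x)) := by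
  have hjsa : jᴴ = j := by subst hj; simp [Matrix.fromBlocks_conjTranspose]
  have hΛadj (x : ℝ) (hx : 0 ≤ x) :
      ((-Complex.I) • (𝒜 * Λ x * j * H x))ᴴ = Complex.I • (H x * j * (Λ x)ᴴ * 𝒜ᴴ) := by
    simp [Matrix.conjTranspose_mul, hjsa, hHsa x hx, Matrix.mul_assoc]
  have hSsa (x : ℝ) (hx : 0 ≤ x) : (S x)ᴴ = S x := by
    have h := matrix_eq_of_hasDerivAt_zero (M := fun t => (S t)ᴴ - S t) (fun y hy i k => by
      refine ((hasDerivAt_matrix_conjTranspose_apply (hS y hy) i k).sub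
        (hS y hy i k)).congr_deriv ?_
      have hsymm : (Λ y * j * H y * j * (Λ y)ᴴ)ᴴ = Λ y * j * H y * j * (Λ y)ᴴ := by
        simp [Matrix.conjTranspose_mul, hjsa, hHsa y hy, Matrix.mul_assoc]
      rw [hsymm, sub_self]) hx
    simp only [hS0sa, sub_self] at h
    exact sub_eq_zero.1 h
  have hid (x : ℝ) (hx : 0 ≤ x) :
      𝒜 * S x - S x * 𝒜ᴴ = Complex.I • (Λ x * j * (Λ x)ᴴ) := by
    have h := matrix_eq_of_hasDerivAt_zero
      (M := fun t => 𝒜 * S t - S t * 𝒜ᴴ - Complex.I • (Λ t * j * (Λ t)ᴴ)) (fun y hy i k => by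
      have h := ((hasDerivAt_matrix_const_mul_apply 𝒜 (hS y hy) i k).sub
        (hasDerivAt_matrix_mul_const_apply (hS y hy) 𝒜ᴴ i k)).sub
        ((hasDerivAt_matrix_mul_apply (hasDerivAt_matrix_mul_const_apply (hΛ y hy) j)
          (hasDerivAt_matrix_conjTranspose_apply (hΛ y hy)) i k).const_smul Complex.I)
      rw [hΛadj y hy, ← Matrix.sub_apply, ← Matrix.smul_apply, ← Matrix.sub_apply] at h
      refine h.congr_deriv
        ((congrArg (fun X : Matrix _ _ ℂ => X i k) ?_).trans (Matrix.zero_apply i k))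
      simp only [Matrix.mul_smul, Matrix.smul_mul, smul_add, smul_smul, smul_neg, Matrix.neg_mul,
        Complex.I_mul_I, neg_neg, one_smul, neg_smul, Matrix.mul_assoc]
      abel) hx
    simp only [hid0, sub_self] at h
    exact sub_eq_zero.1 h
  have hT (x : ℝ) (hx : 0 ≤ x) := inv_mul_sub_mul_inv_of_identity (hSinv x hx) (hid x hx)
  have hmulinv (ζ : ℂ) (hζ : IsUnit (𝒜 - ζ • 1)) :
      (𝒜 - ζ • 1) * (𝒜 - ζ • 1)⁻¹ = 1 :=
    Matrix.mul_nonsing_inv _ ((Matrix.isUnit_iff_isUnit_det _).1 hζ)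
  have hinvmul (ζ : ℂ) (hζ : IsUnit (𝒜 - ζ • 1)) :
      (𝒜 - ζ • 1)⁻¹ * (𝒜 - ζ • 1) = 1 :=
    Matrix.nonsing_inv_mul _ ((Matrix.isUnit_iff_isUnit_det _).1 hζ)
  have h𝒜0 : IsUnit (𝒜 - (0 : ℂ) • 1) := by simpa using h𝒜
  have hC : (𝒜ᴴ)⁻¹ * 𝒜ᴴ = 1 :=
    Matrix.nonsing_inv_mul _ ((Matrix.isUnit_iff_isUnit_det _).1 (by simpa using h𝒜.star))
  have hprod (x : ℝ) (hx : 0 ≤ x) (ζ : ℂ) (hζ : IsUnit (𝒜 - ζ • 1)) :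
      (1 + Complex.I • (j * (Λ x)ᴴ * (𝒜ᴴ)⁻¹ * (S x)⁻¹ * Λ x)) * w𝒜 x ζ =
        1 - (Complex.I * ζ) •
          (j * (Λ x)ᴴ * (𝒜ᴴ)⁻¹ * (S x)⁻¹ * (𝒜 - ζ • 1)⁻¹ * Λ x) := by
    rw [hw𝒜]
    exact transferMatrix_mul (hT x hx) (hmulinv ζ hζ) hC
  have hw0inv (x : ℝ) (hx : 0 ≤ x) :
      (1 + Complex.I • (j * (Λ x)ᴴ * (𝒜ᴴ)⁻¹ * (S x)⁻¹ * Λ x)) * w𝒜 x 0 = 1 := by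
    simpa using hprod x hx 0 h𝒜0
  have hinv (x : ℝ) (hx : 0 ≤ x) :
      (w𝒜 x 0)⁻¹ = 1 + Complex.I • (j * (Λ x)ᴴ * (𝒜ᴴ)⁻¹ * (S x)⁻¹ * Λ x) :=
    Matrix.inv_eq_left_inv (hw0inv x hx)
  have hw0unit (x : ℝ) (hx : 0 ≤ x) : IsUnit (w𝒜 x 0) :=
    (Matrix.isUnit_iff_isUnit_det _).2 (Matrix.isUnit_det_of_left_inverse (hw0inv x hx))
  have hjw (x : ℝ) (hx : 0 ≤ x) : j * (w𝒜 x 0)ᴴ = (w𝒜 x 0)⁻¹ * j := by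
    rw [hinv x hx, hw𝒜]
    simp [Matrix.conjTranspose_mul, Matrix.conjTranspose_nonsing_inv, hSsa x hx, hjsa,
      Matrix.mul_add, Matrix.add_mul, Matrix.mul_assoc]
  have hwderiv (x : ℝ) (hx : 0 ≤ x) (ζ : ℂ) (hζ : IsUnit (𝒜 - ζ • 1)) :
      ∀ i k, HasDerivAt (fun t => w𝒜 t ζ i k)
        (((Complex.I * ζ) • (j * H x * w𝒜 x ζ - w𝒜 x ζ * j * H x)
          + (j * H x * j * (Λ x)ᴴ * (S x)⁻¹ * Λ x - j * (Λ x)ᴴ * (S x)⁻¹ * Λ x * j * H x)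
            * w𝒜 x ζ) i k) x := by
    intro i k
    have h := ((hasDerivAt_matrix_mul_apply (hasDerivAt_matrix_mul_const_apply
      (hasDerivAt_matrix_mul_apply
        (hasDerivAt_matrix_const_mul_apply j (hasDerivAt_matrix_conjTranspose_apply (hΛ x hx)))
        (hasDerivAt_matrix_inv_apply (hS x hx) (hSinv x hx))) (𝒜 - ζ • 1)⁻¹)
      (hΛ x hx) i k).const_smul Complex.I).const_sub ((1 : Matrix _ _ ℂ) i k)
    rw [← Matrix.smul_apply, ← Matrix.neg_apply, transferMatrix_deriv_identity (ζ := ζ) hjsa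
      (hHsa x hx) (hT x hx)
      (by have := hmulinv ζ hζ
          rwa [sub_mul, Matrix.smul_mul, one_mul, sub_eq_iff_eq_add] at this)
      (by have := hinvmul ζ hζ
          rwa [mul_sub, Matrix.mul_smul, mul_one, sub_eq_iff_eq_add] at this), ← hw𝒜] at h
    simp only [hw𝒜 _ ζ] at h ⊢
    exact h
  have hHtilsa (x : ℝ) (hx : 0 ≤ x) : (Htil x)ᴴ = Htil x := by
    rw [hHtil, Matrix.conjTranspose_mul, Matrix.conjTranspose_mul,
      Matrix.conjTranspose_conjTranspose, hHsa x hx, Matrix.mul_assoc]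
  refine ⟨hHtilsa, fun hpos x hx => ?_, fun x hx i k => ?_, fun x hx => ?_⟩
  · rw [hHtil]
    exact (hpos x hx).conjTranspose_mul_mul_same _
  · have h := hasDerivAt_matrix_mul_apply
      (hasDerivAt_matrix_inv_apply (hwderiv x hx 0 h𝒜0) (hw0unit x hx))
      (hwderiv x hx lam hlam) i k
    simp only [hv]
    refine h.congr_deriv (congrArg (fun X : Matrix _ _ ℂ => X i k) ?_)
    have hdet := (Matrix.isUnit_iff_isUnit_det _).1 (hw0unit x hx)
    have hcancel (X Y : Matrix (Fin m₁ ⊕ Fin m₂) (Fin m₁ ⊕ Fin m₂) ℂ) :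
        (w𝒜 x 0)⁻¹ * (X * w𝒜 x 0) * (w𝒜 x 0)⁻¹ * Y = (w𝒜 x 0)⁻¹ * (X * Y) := by
      rw [← mul_assoc, Matrix.mul_nonsing_inv_cancel_right _ _ hdet, mul_assoc]
    have hjH : j * Htil x * ((w𝒜 x 0)⁻¹ * w𝒜 x lam) = (w𝒜 x 0)⁻¹ * (j * H x * w𝒜 x lam) := by
      rw [hHtil, ← mul_assoc, ← mul_assoc, ← mul_assoc, hjw x hx,
        Matrix.mul_nonsing_inv_cancel_right _ _ hdet]
      simp only [mul_assoc]
    rw [hjH, mul_zero, zero_smul, zero_add, neg_mul, hcancel, mul_add _ (_ • _), Matrix.mul_smul,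
      mul_sub, smul_sub]
    simp only [mul_assoc]
    abel
  · rw [hv, hinv x hx]
    exact hprod x hx lam hlam
end

section
/- Assume the GBDT data, and assume in addition that H(x) ≥ 0 (positive semidefinite) for all x ≥ 0 and that S(0) > 0 (positive definite). Then S(x) > 0 (positive definite), and in particular S(x) is invertible, for every x ≥ 0. -/
open Matrix
open scoped ComplexOrder

/-- If a matrix-valued function has an entrywise positive semidefinite derivative on `[0, ∞)`,
then its increments from `0` are positive semidefinite. -/
theorem posSemidef_sub_of_hasDerivAt_posSemidef {n : Type*} [Fintype n]
    {S D : ℝ → Matrix n n ℂ} (hD : ∀ x : ℝ, 0 ≤ x → (D x).PosSemidef)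
    (hS : ∀ x : ℝ, 0 ≤ x → ∀ i k, HasDerivAt (fun t => S t i k) (D x i k) x)
    (h0 : (S 0).IsHermitian) {x : ℝ} (hx : 0 ≤ x) : (S x - S 0).PosSemidef := by
  have hherm : (S x).IsHermitian := by
    ext i k
    have hd : ∀ t : ℝ, 0 ≤ t → HasDerivAt (fun t => star (S t k i) - S t i k) 0 t := by
      intro t ht
      have h := (hS t ht k i).star.sub (hS t ht i k)
      rwa [(hD t ht).isHermitian.apply, sub_self] at h
    have hc := constant_of_has_deriv_right_zero (a := 0) (b := x)
      (fun t ht => (hd t ht.1).continuousAt.continuousWithinAt)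
      (fun t ht => (hd t ht.1).hasDerivWithinAt) x ⟨hx, le_rfl⟩
    rw [h0.apply, sub_self, sub_eq_zero] at hc
    exact hc
  refine PosSemidef.of_dotProduct_mulVec_nonneg (hherm.sub h0) fun v => ?_
  have hq : ∀ t : ℝ, 0 ≤ t →
      HasDerivAt (fun t => star v ⬝ᵥ S t *ᵥ v) (star v ⬝ᵥ D t *ᵥ v) t := by
    intro t ht
    simp only [dotProduct, mulVec]
    exact HasDerivAt.fun_sum fun i _ =>
      (HasDerivAt.fun_sum fun k _ => (hS t ht i k).mul_const (v k)).const_mul _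
  have hre : ∀ t : ℝ, 0 ≤ t →
      HasDerivAt (fun t => (star v ⬝ᵥ S t *ᵥ v).re) (star v ⬝ᵥ D t *ᵥ v).re t := fun t ht =>
    Complex.reCLM.hasFDerivAt.comp_hasDerivAt t (hq t ht)
  have hmono : MonotoneOn (fun t => (star v ⬝ᵥ S t *ᵥ v).re) (Set.Ici 0) := by
    refine monotoneOn_of_hasDerivWithinAt_nonneg (convex_Ici 0)
      (fun t ht => (hre t ht).continuousAt.continuousWithinAt)
      (fun t ht => (hre t (interior_subset ht)).hasDerivWithinAt) fun t ht => ?_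
    exact (Complex.nonneg_iff.mp ((hD t (interior_subset ht)).dotProduct_mulVec_nonneg v)).1
  have hle := hmono Set.self_mem_Ici hx hx
  refine Complex.nonneg_iff.mpr ⟨?_, ((hherm.sub h0).im_star_dotProduct_mulVec_self v).symm⟩
  rw [sub_mulVec, dotProduct_sub, Complex.sub_re]
  exact sub_nonneg.mpr hle

/-- Under the GBDT data, if moreover `H(x) ≥ 0` for all `x ≥ 0` and `S(0) > 0`,
then `S(x) > 0` (in particular `S(x)` is invertible) for every `x ≥ 0`. -/
theorem gbdt_S_posdef
    {m₁ m₂ n : ℕ} (hm₁ : 0 < m₁) (hm₂ : 0 < m₂) (hn : 0 < n)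
    (j : Matrix (Fin m₁ ⊕ Fin m₂) (Fin m₁ ⊕ Fin m₂) ℂ)
    (hj : j = Matrix.fromBlocks 1 0 0 (-1))
    (H : ℝ → Matrix (Fin m₁ ⊕ Fin m₂) (Fin m₁ ⊕ Fin m₂) ℂ)
    (hHcont : Continuous H)
    (hHsa : ∀ x : ℝ, 0 ≤ x → (H x)ᴴ = H x)
    (hHpsd : ∀ x : ℝ, 0 ≤ x → (H x).PosSemidef)
    (𝒜 : Matrix (Fin n) (Fin n) ℂ)
    (S : ℝ → Matrix (Fin n) (Fin n) ℂ)
    (Λ : ℝ → Matrix (Fin n) (Fin m₁ ⊕ Fin m₂) ℂ)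
    (hS0 : (S 0).PosDef)
    (hid0 : 𝒜 * S 0 - S 0 * 𝒜ᴴ = Complex.I • (Λ 0 * j * (Λ 0)ᴴ))
    (hΛ : ∀ x : ℝ, 0 ≤ x → ∀ i k, HasDerivAt (fun t => Λ t i k)
      (((-Complex.I) • (𝒜 * Λ x * j * H x)) i k) x)
    (hS : ∀ x : ℝ, 0 ≤ x → ∀ i k, HasDerivAt (fun t => S t i k)
      ((Λ x * j * H x * j * (Λ x)ᴴ) i k) x) :
    ∀ x : ℝ, 0 ≤ x → (S x).PosDef ∧ IsUnit (S x) := by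
  have hjs : jᴴ = j := by
    rw [hj, fromBlocks_conjTranspose]
    simp
  intro x hx
  have hpsd : (S x - S 0).PosSemidef := by
    refine posSemidef_sub_of_hasDerivAt_posSemidef (fun t ht => ?_) hS hS0.isHermitian hx
    have h := (hHpsd t ht).mul_mul_conjTranspose_same (Λ t * j)
    rwa [conjTranspose_mul, hjs, ← Matrix.mul_assoc] at h
  have hpd : (S x).PosDef := by
    simpa using hS0.add_posSemidef hpsd
  exact ⟨hpd, hpd.isUnit⟩
end
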